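/- Let M be a q×s matrix with orthonormal columns where s < q/2, and β > 0. If ξ ∼ N(0, I_q) and x = β(I - MMᵀ)ξ, then for all z > 0, Pr( ‖x‖_∞ / ‖x‖₂ ≥ z/√q ) ≤ 2q·exp(-z²/8) + exp(-q/48). -/

import Mathlib

open Matrix MeasureTheory ProbabilityTheory

lemma tail_lin (q : ℕ) (a : Fin q → ℝ) (ha : ∑ j, a j ^ 2 ≤ 1) (t : ℝ) (ht : 0 ≤ t) :
    (Measure.pi fun _ : Fin q => gaussianReal 0 1).real {ξ | t ≤ ∑ j, a j * ξ j} ≤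
      Real.exp (-t ^ 2 / 2) := by
  have he : (fun ξ : Fin q → ℝ => Real.exp (t * ∑ j, a j * ξ j)) =
      fun ξ => ∏ j, (fun x => Real.exp (t * a j * x)) (ξ j) := by
    ext ξ
    rw [← Real.exp_sum, Finset.mul_sum]
    congr 1
    exact Finset.sum_congr rfl fun j _ => by ring
  have hint : Integrable (fun ξ : Fin q → ℝ => Real.exp (t * ∑ j, a j * ξ j))
      (Measure.pi fun _ : Fin q => gaussianReal 0 1) := by
    rw [he]
    exact Integrable.fintype_prod fun j => integrable_exp_mul_gaussianReal _
  refine (measure_ge_le_exp_mul_mgf t ht hint).trans ?_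
  have hm : mgf (fun ξ : Fin q → ℝ => ∑ j, a j * ξ j)
      (Measure.pi fun _ : Fin q => gaussianReal 0 1) t = Real.exp (t ^ 2 * (∑ j, a j ^ 2) / 2) := by
    rw [mgf, he, integral_fintype_prod_eq_prod (f := fun j x => Real.exp (t * a j * x))]
    have : ∀ j, ∫ x, Real.exp (t * a j * x) ∂(gaussianReal 0 1) = Real.exp (t ^ 2 * a j ^ 2 / 2) := by
      intro j
      have := congrFun (mgf_fun_id_gaussianReal (μ := 0) (v := 1)) (t * a j)
      rw [mgf] at this
      rw [this]; congr 1; push_cast; ring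
    simp_rw [this]
    rw [← Real.exp_sum, ← Finset.sum_div, Finset.mul_sum]
  rw [hm, ← Real.exp_add, Real.exp_le_exp]
  nlinarith [sq_nonneg t]

lemma gauss_half : ∫ x, Real.exp (-(x ^ 2) / 2) ∂(gaussianReal 0 1) = (√2)⁻¹ := by
  rw [integral_gaussianReal_eq_integral_smul (by norm_num)]
  have : ∀ x : ℝ, gaussianPDFReal 0 1 x • Real.exp (-(x ^ 2) / 2) =
      (√(2 * Real.pi))⁻¹ * Real.exp (-1 * x ^ 2) := by
    intro x
    rw [gaussianPDFReal, smul_eq_mul, mul_assoc, ← Real.exp_add]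
    simp only [NNReal.coe_one, mul_one, sub_zero]
    congr 2; ring
  simp_rw [this]
  rw [integral_const_mul, integral_gaussian, div_one, Real.sqrt_mul (by norm_num)]
  have : √Real.pi ≠ 0 := (Real.sqrt_pos.2 Real.pi_pos).ne'
  field_simp

lemma std_exp (E : Type*) [NormedAddCommGroup E] [InnerProductSpace ℝ E] [FiniteDimensional ℝ E]
    [MeasurableSpace E] [BorelSpace E] :
    ∫ x, Real.exp (-(‖x‖ ^ 2) / 2) ∂(stdGaussian E) = (√2)⁻¹ ^ (Module.finrank ℝ E) := by
  rw [stdGaussian, integral_map (Measurable.aemeasurable (by fun_prop)) (by fun_prop)]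
  have : ∀ x : Fin (Module.finrank ℝ E) → ℝ,
      Real.exp (-(‖∑ i, x i • stdOrthonormalBasis ℝ E i‖ ^ 2) / 2) =
      ∏ i, Real.exp (-(x i ^ 2) / 2) := by
    intro x
    rw [← Real.exp_sum, ← Finset.sum_div, Finset.sum_neg_distrib]
    congr 3
    rw [← (stdOrthonormalBasis ℝ E).sum_sq_norm_inner_right]
    refine Finset.sum_congr rfl fun i _ => ?_
    rw [(stdOrthonormalBasis ℝ E).orthonormal.inner_right_fintype]
    simp
  simp_rw [this]
  rw [integral_fintype_prod_eq_prod (f := fun _ x => Real.exp (-(x ^ 2) / 2))]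
  simp [gauss_half]

lemma std_proj (E : Type*) [NormedAddCommGroup E] [InnerProductSpace ℝ E] [FiniteDimensional ℝ E]
    [MeasurableSpace E] [BorelSpace E] (K : Submodule ℝ E) :
    (stdGaussian E).map K.orthogonalProjectionOnto = stdGaussian K := by
  apply Measure.ext_of_charFun
  ext t
  rw [charFun_apply, integral_map (by fun_prop) (by fun_prop), charFun_stdGaussian,
    show ‖t‖ = ‖(t : E)‖ from rfl, ← charFun_stdGaussian, charFun_apply]
  congr 1
  ext x
  rw [Submodule.inner_orthogonalProjectionOnto_eq_of_mem_right]

lemma std_tail (E : Type*) [NormedAddCommGroup E] [InnerProductSpace ℝ E] [FiniteDimensional ℝ E]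
    [MeasurableSpace E] [BorelSpace E] (q : ℕ) (h : q ≤ 2 * Module.finrank ℝ E) :
    (stdGaussian E).real {x | ‖x‖ ^ 2 ≤ (q : ℝ) / 4} ≤ Real.exp (-(q : ℝ) / 48) := by
  have hint : Integrable (fun x : E => Real.exp (-(1/2) * ‖x‖ ^ 2)) (stdGaussian E) := by
    refine Integrable.of_bound (by fun_prop) 1 (.of_forall fun x => ?_)
    rw [Real.norm_eq_abs, Real.abs_exp, Real.exp_le_one_iff]
    nlinarith [sq_nonneg ‖x‖]
  refine (measure_le_le_exp_mul_mgf ((q : ℝ) / 4) (by norm_num) hint).trans ?_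
  have : mgf (fun x : E => ‖x‖ ^ 2) (stdGaussian E) (-(1/2)) = (√2)⁻¹ ^ (Module.finrank ℝ E) := by
    rw [← std_exp, mgf]
    congr 1; ext x; ring_nf
  have h2 : (√2)⁻¹ = Real.exp (-(Real.log 2 / 2)) := by
    rw [Real.exp_neg, Real.exp_half, Real.exp_log (by norm_num)]
  rw [this, h2, ← Real.exp_nat_mul, ← Real.exp_add, Real.exp_le_exp]
  have h' : (q : ℝ) ≤ 2 * Module.finrank ℝ E := by exact_mod_cast h
  have := Real.log_two_gt_d9
  have hq : (0 : ℝ) ≤ q := by positivity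
  nlinarith

lemma proj_tail (q s : ℕ) (hs : 2 * s < q)
    (M : Matrix (Fin q) (Fin s) ℝ) (hM : Mᵀ * M = 1) :
    (Measure.pi fun _ : Fin q => gaussianReal 0 1).real
      {ξ | ∑ l, ((1 - M * Mᵀ).mulVec ξ l) ^ 2 ≤ (q : ℝ) / 4} ≤ Real.exp (-(q : ℝ) / 48) := by
  let f : EuclideanSpace ℝ (Fin q) →ₗ[ℝ] (Fin s → ℝ) :=
    Mᵀ.mulVecLin ∘ₗ (WithLp.linearEquiv 2 ℝ (Fin q → ℝ)).toLinearMap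
  let K := LinearMap.ker f
  have hK : q ≤ 2 * Module.finrank ℝ K := by
    have h1 := f.finrank_range_add_finrank_ker
    have h2 := Submodule.finrank_le (LinearMap.range f)
    simp at h1 h2
    change q ≤ 2 * Module.finrank ℝ (LinearMap.ker f)
    omega
  have key : ∀ ξ : Fin q → ℝ, ‖K.orthogonalProjectionOnto (WithLp.toLp 2 ξ)‖ ^ 2 =
      ∑ l, ((1 - M * Mᵀ).mulVec ξ l) ^ 2 := by
    intro ξ
    have : K.starProjection (WithLp.toLp 2 ξ) = WithLp.toLp 2 ((1 - M * Mᵀ).mulVec ξ) := by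
      apply Submodule.eq_starProjection_of_mem_of_inner_eq_zero
      · simp only [K, f, LinearMap.mem_ker]
        change Mᵀ *ᵥ ((1 - M * Mᵀ) *ᵥ ξ) = 0
        rw [Matrix.mulVec_mulVec, Matrix.mul_sub, ← Matrix.mul_assoc, hM]
        simp
      · intro w hw
        have hw' : Mᵀ *ᵥ (WithLp.ofLp w) = 0 := hw
        rw [← WithLp.toLp_sub, ← WithLp.toLp_ofLp 2 w, EuclideanSpace.inner_toLp_toLp]
        simp only [star_trivial, Matrix.sub_mulVec, Matrix.one_mulVec, sub_sub_cancel]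
        rw [← Matrix.mulVec_mulVec, Matrix.dotProduct_mulVec, ← Matrix.mulVec_transpose, hw',
          zero_dotProduct]
    rw [show ‖K.orthogonalProjectionOnto (WithLp.toLp 2 ξ)‖ = ‖(K.orthogonalProjectionOnto (WithLp.toLp 2 ξ) : EuclideanSpace ℝ (Fin q))‖ from rfl,
      Submodule.coe_orthogonalProjectionOnto_apply, this,
      EuclideanSpace.real_norm_sq_eq]
  have hms : MeasurableSet {x : K | ‖x‖ ^ 2 ≤ (q : ℝ) / 4} :=
    measurableSet_le (by fun_prop) (by fun_prop)
  have := std_tail K q hK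
  rw [← std_proj, ← map_pi_eq_stdGaussian, map_measureReal_apply (by fun_prop) hms,
    map_measureReal_apply (by fun_prop) (hms.preimage (by fun_prop))] at this
  convert this using 2
  ext ξ
  simp only [Set.mem_ofPred_eq, Set.mem_preimage, key]

theorem stmt_10 (q s : ℕ) (hs : 2 * s < q) (β : ℝ) (hβ : 0 < β)
    (M : Matrix (Fin q) (Fin s) ℝ) (hM : Mᵀ * M = 1) (z : ℝ) (hz : 0 < z) :
    (Measure.pi fun _ : Fin q => gaussianReal 0 1)
      {ξ | z / Real.sqrt q ≤
        (⨆ l, |β * ((1 - M * Mᵀ).mulVec ξ l)|) /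
          Real.sqrt (∑ l, (β * ((1 - M * Mᵀ).mulVec ξ l)) ^ 2)} ≤
      ENNReal.ofReal (2 * q * Real.exp (-z ^ 2 / 8) + Real.exp (-(q : ℝ) / 48)) := by
  have hq : 0 < q := by omega
  have hq' : (0 : ℝ) < q := by exact_mod_cast hq
  have : Nonempty (Fin q) := ⟨⟨0, hq⟩⟩
  set P := 1 - M * Mᵀ with hP
  have hrow : ∀ l, ∑ j, P l j ^ 2 ≤ 1 := by
    intro l
    have hPP : P * Pᵀ = P := by
      rw [hP, Matrix.transpose_sub, Matrix.transpose_mul, Matrix.transpose_transpose,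
        Matrix.transpose_one, Matrix.mul_sub, Matrix.sub_mul, Matrix.sub_mul]
      rw [show M * Mᵀ * (M * Mᵀ) = M * (Mᵀ * M) * Mᵀ by simp only [Matrix.mul_assoc], hM]
      simp
    have h1 : ∑ j, P l j ^ 2 = P l l := by
      conv_rhs => rw [← hPP]
      rw [Matrix.mul_apply]
      exact Finset.sum_congr rfl fun j _ => by rw [Matrix.transpose_apply, sq]
    rw [h1, hP, Matrix.sub_apply, Matrix.one_apply_eq, Matrix.mul_apply]
    have : 0 ≤ ∑ j, M l j * Mᵀ j l :=
      Finset.sum_nonneg fun j _ => by rw [Matrix.transpose_apply]; exact mul_self_nonneg _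
    linarith
  set μ := Measure.pi fun _ : Fin q => gaussianReal 0 1
  have hsub : {ξ : Fin q → ℝ | z / Real.sqrt q ≤
        (⨆ l, |β * (P.mulVec ξ l)|) / Real.sqrt (∑ l, (β * (P.mulVec ξ l)) ^ 2)} ⊆
      (⋃ l : Fin q, ({ξ | z / 2 ≤ ∑ j, P l j * ξ j} ∪ {ξ | z / 2 ≤ ∑ j, (-P l j) * ξ j})) ∪
      {ξ | ∑ l, (P.mulVec ξ l) ^ 2 ≤ (q : ℝ) / 4} := by
    intro ξ hξ
    by_cases hc : ∑ l, (P.mulVec ξ l) ^ 2 ≤ (q : ℝ) / 4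
    · exact Or.inr hc
    left
    push Not at hc
    rw [Set.mem_ofPred_eq] at hξ
    simp_rw [mul_pow, ← Finset.mul_sum] at hξ
    rw [Real.sqrt_mul (by positivity), Real.sqrt_sq hβ.le] at hξ
    obtain ⟨l, hl⟩ := exists_eq_ciSup_of_finite (f := fun l => |β * (P.mulVec ξ l)|)
    rw [← hl, abs_mul, abs_of_pos hβ, mul_div_mul_left _ _ hβ.ne'] at hξ
    have hn : √q / 2 ≤ √(∑ l, (P.mulVec ξ l) ^ 2) := by
      apply Real.le_sqrt_of_sq_le
      rw [div_pow, Real.sq_sqrt hq'.le]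
      linarith
    have hsq : 0 < √(q : ℝ) := Real.sqrt_pos.2 hq'
    rw [le_div_iff₀ (by linarith)] at hξ
    have h2 : z / 2 ≤ |P.mulVec ξ l| := by
      refine le_trans ?_ hξ
      calc z / 2 = z / √q * (√q / 2) := by field_simp
        _ ≤ _ := by gcongr
    refine Set.mem_iUnion.2 ⟨l, ?_⟩
    rcases le_abs.1 h2 with h | h
    · left; exact h
    · right
      simp only [Set.mem_ofPred_eq, neg_mul, Finset.sum_neg_distrib]
      exact h
  rw [← ENNReal.ofReal_toReal (measure_ne_top μ _)]
  apply ENNReal.ofReal_le_ofReal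
  refine (measureReal_mono hsub).trans ((measureReal_union_le _ _).trans ?_)
  refine add_le_add ?_ (proj_tail q s hs M hM)
  refine (measureReal_iUnion_fintype_le _).trans ?_
  have hb : ∀ l : Fin q, μ.real ({ξ | z / 2 ≤ ∑ j, P l j * ξ j} ∪
      {ξ | z / 2 ≤ ∑ j, (-P l j) * ξ j}) ≤ 2 * Real.exp (-z ^ 2 / 8) := by
    intro l
    have e : -z ^ 2 / 8 = -(z / 2) ^ 2 / 2 := by ring
    refine (measureReal_union_le _ _).trans ?_
    rw [two_mul, e]
    exact add_le_add (tail_lin q _ (hrow l) _ (by positivity))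
      (tail_lin q (fun j => -P l j) (by simpa using hrow l) _ (by positivity))
  refine (Finset.sum_le_sum fun l _ => hb l).trans ?_
  simp
  apply le_of_eq; ring
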